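/- Let X = (x_n)_{n∈N} be a greedy basis of a real or complex Banach space X whose fundamental function φ_u[X] is equivalent to the sequence σ_α(m) = m^α for some 0 < α < 1. Then X admits an equivalent norm with respect to which X is isometrically greedy, isometrically bidemocratic, and lattice 1-unconditional, and the fundamental function of X relative to the new norm equals σ_α. -/

import Mathlib

open scoped BigOperators ENNReal NNReal
open MeasureTheory

noncomputable section

namespace GreedyRenorm

/-! ### Sequence notions.  Sequences are indexed by `ℕ`, understood as defined on the
positive integers, with the convention that the value at `0` is `0` where relevant. -/

/-- `σ` is nondecreasing (on the positive integers). -/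
def MonoFrom1 (σ : ℕ → ℝ) : Prop := ∀ m : ℕ, 1 ≤ m → σ m ≤ σ (m + 1)

/-- The dual sequence `σ*(m) = m / σ(m)` is nondecreasing (on the positive integers). -/
def DualMonoFrom1 (σ : ℕ → ℝ) : Prop :=
  ∀ m : ℕ, 1 ≤ m → (m : ℝ) / σ m ≤ ((m : ℝ) + 1) / σ (m + 1)

/-- Lower regularity property: `σ (r m) ≥ 2 σ m` for some positive integer `r`. -/
def HasLRP (σ : ℕ → ℝ) : Prop :=
  ∃ r : ℕ, 1 ≤ r ∧ ∀ m : ℕ, 1 ≤ m → 2 * σ m ≤ σ (r * m)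

/-- Upper regularity property: `σ (r m) ≤ (r/2) σ m` for some positive integer `r`. -/
def HasURP (σ : ℕ → ℝ) : Prop :=
  ∃ r : ℕ, 1 ≤ r ∧ ∀ m : ℕ, 1 ≤ m → σ (r * m) ≤ ((r : ℝ) / 2) * σ m

/-- Dini regularity: the discrete derivative of `σ` is equivalent to `σ(m)/m`. -/
def DiniRegular (σ : ℕ → ℝ) : Prop :=
  ∃ C : ℝ, 1 ≤ C ∧ ∀ m : ℕ, 1 ≤ m →
    (1 / C) * (σ m / (m : ℝ)) ≤ σ m - σ (m - 1) ∧
      σ m - σ (m - 1) ≤ C * (σ m / (m : ℝ))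

/-- `σ` and `τ` are equivalent sequences (on the positive integers). -/
def EquivSeq (σ τ : ℕ → ℝ) : Prop :=
  ∃ D : ℝ, 1 ≤ D ∧ ∀ m : ℕ, 1 ≤ m → (1 / D) * τ m ≤ σ m ∧ σ m ≤ D * τ m

/-- `σ` is a Dini regularization of `τ`: it is Dini-regular and equivalent to `τ`
(with the convention `σ 0 = 0`). -/
def DiniRegularization (σ τ : ℕ → ℝ) : Prop :=
  σ 0 = 0 ∧ DiniRegular σ ∧ EquivSeq σ τ

/-- A Dini regularization of `τ` which is positive and such that both it and its dual
sequence are nondecreasing. -/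
def GoodDiniReg (σ τ : ℕ → ℝ) : Prop :=
  DiniRegularization σ τ ∧ (∀ m : ℕ, 1 ≤ m → 0 < σ m) ∧ MonoFrom1 σ ∧ DualMonoFrom1 σ

/-! ### Fundamental functions and norms -/

/-- The fundamental function of a family `y` computed with respect to a gauge `ν`:
`m ↦ sup { ν (∑_{n ∈ A} ε n • y n) : |A| ≤ m, |ε n| = 1 }`. -/
def fundFunWith (𝕜 : Type*) [RCLike 𝕜] {N Y : Type*} [AddCommGroup Y] [Module 𝕜 Y]
    (ν : Y → ℝ) (y : N → Y) (m : ℕ) : ℝ :=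
  sSup {r : ℝ | ∃ (A : Finset N) (ε : N → 𝕜), A.card ≤ m ∧ (∀ n, ‖ε n‖ = 1) ∧
    r = ν (∑ n ∈ A, ε n • y n)}

/-- The fundamental function of a family `y` in a normed space. -/
def fundFun (𝕜 : Type*) [RCLike 𝕜] {N Y : Type*} [SeminormedAddCommGroup Y]
    [NormedSpace 𝕜 Y] (y : N → Y) (m : ℕ) : ℝ :=
  fundFunWith 𝕜 (fun v => ‖v‖) y m

/-- `ν` is an equivalent norm on the normed space `X`. -/
structure IsEquivNorm (𝕜 : Type*) [RCLike 𝕜] {X : Type*} [NormedAddCommGroup X]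
    [NormedSpace 𝕜 X] (ν : X → ℝ) : Prop where
  add_le : ∀ f g : X, ν (f + g) ≤ ν f + ν g
  smul_eq : ∀ (a : 𝕜) (f : X), ν (a • f) = ‖a‖ * ν f
  lower : ∃ c : ℝ, 0 < c ∧ ∀ f : X, c * ‖f‖ ≤ ν f
  upper : ∃ C : ℝ, 0 < C ∧ ∀ f : X, ν f ≤ C * ‖f‖

section Basis

variable {𝕜 : Type*} [RCLike 𝕜] {N : Type*} {X : Type*}
  [NormedAddCommGroup X] [NormedSpace 𝕜 X]

/-- The dual norm, relative to the gauge `ν` on `X`, of a functional `g`. -/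
def dualNormWith (ν : X → ℝ) (g : X →L[𝕜] 𝕜) : ℝ :=
  sSup {r : ℝ | ∃ f : X, ν f ≤ 1 ∧ r = ‖g f‖}

/-- The fundamental function of the dual system `xs`, computed with the dual norm of `ν`. -/
def dualFundFunWith (ν : X → ℝ) (xs : N → X →L[𝕜] 𝕜) (m : ℕ) : ℝ :=
  sSup {r : ℝ | ∃ (B : Finset N) (δ : N → 𝕜), B.card ≤ m ∧ (∀ n, ‖δ n‖ = 1) ∧
    r = dualNormWith ν (∑ n ∈ B, δ n • xs n)}

/-- `A` is a greedy set of `f` with respect to the coordinate functionals `xs`. -/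
def GreedySet (xs : N → X →L[𝕜] 𝕜) (f : X) (A : Finset N) : Prop :=
  ∀ n ∈ A, ∀ k, k ∉ A → ‖xs k f‖ ≤ ‖xs n f‖

/-- `S_A(f) = ∑_{n ∈ A} x_n^*(f) • x_n`. -/
def greedyProj (x : N → X) (xs : N → X →L[𝕜] 𝕜) (A : Finset N) (f : X) : X :=
  ∑ n ∈ A, xs n f • x n

/-- A complete minimal system with its (biorthogonal) dual system. -/
structure IsCompleteMinimal (x : N → X) (xs : N → X →L[𝕜] 𝕜) : Prop where
  dense_span : (Submodule.span 𝕜 (Set.range x)).topologicalClosure = ⊤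
  biorth_diag : ∀ n, xs n (x n) = 1
  biorth_off : ∀ n k, n ≠ k → xs n (x k) = 0

/-- A basis: a complete minimal system which is semi-normalized and `M`-bounded. -/
structure IsBasis (x : N → X) (xs : N → X →L[𝕜] 𝕜) : Prop where
  dense_span : (Submodule.span 𝕜 (Set.range x)).topologicalClosure = ⊤
  biorth_diag : ∀ n, xs n (x n) = 1
  biorth_off : ∀ n k, n ≠ k → xs n (x k) = 0
  norm_pos : ∃ c : ℝ, 0 < c ∧ ∀ n, c ≤ ‖x n‖
  norm_bdd : ∃ C : ℝ, ∀ n, ‖x n‖ ≤ C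
  mBounded : ∃ C : ℝ, ∀ n, ‖x n‖ * ‖xs n‖ ≤ C

/-- The basis is `C`-greedy with respect to the gauge `ν`. -/
def GreedyWith (ν : X → ℝ) (x : N → X) (xs : N → X →L[𝕜] 𝕜) (C : ℝ) : Prop :=
  ∀ (f : X) (A B : Finset N) (a : N → 𝕜), GreedySet xs f A → B.card ≤ A.card →
    ν (f - greedyProj x xs A f) ≤ C * ν (f - ∑ n ∈ B, a n • x n)

/-- The basis is `C`-almost greedy with respect to the gauge `ν`. -/
def AlmostGreedyWith (ν : X → ℝ) (x : N → X) (xs : N → X →L[𝕜] 𝕜) (C : ℝ) : Prop :=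
  ∀ (f : X) (A B : Finset N), GreedySet xs f A → B.card ≤ A.card →
    ν (f - greedyProj x xs A f) ≤ C * ν (f - greedyProj x xs B f)

/-- The basis is `C`-quasi-greedy with respect to the gauge `ν`. -/
def QuasiGreedyWith (ν : X → ℝ) (x : N → X) (xs : N → X →L[𝕜] 𝕜) (C : ℝ) : Prop :=
  ∀ (f : X) (A : Finset N), GreedySet xs f A → ν (greedyProj x xs A f) ≤ C * ν f

/-- The basis is lattice `C`-unconditional with respect to the gauge `ν`. -/
def LatticeUnconditionalWith (ν : X → ℝ) (x : N → X) (xs : N → X →L[𝕜] 𝕜) (C : ℝ) : Prop :=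
  ∀ (f : X) (A : Finset N) (lam : N → 𝕜) (M : ℝ), (∀ n, ‖lam n‖ ≤ M) →
    ν (∑ n ∈ A, lam n • xs n f • x n) ≤ C * M * ν f

/-- The basis is suppression `C`-unconditional (with respect to the ambient norm). -/
def SuppressionUnconditional (x : N → X) (xs : N → X →L[𝕜] 𝕜) (C : ℝ) : Prop :=
  ∀ (f : X) (A : Finset N), ‖greedyProj x xs A f‖ ≤ C * ‖f‖

/-- The family `x` is `C`-democratic (with respect to the ambient norm). -/
def Democratic (x : N → X) (C : ℝ) : Prop :=
  ∀ A B : Finset N, A.card ≤ B.card → ‖∑ n ∈ A, x n‖ ≤ C * ‖∑ n ∈ B, x n‖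

/-- The basis is `C`-bidemocratic (with respect to the ambient norm; the dual system
carries the operator norm). -/
def Bidemocratic (x : N → X) (xs : N → X →L[𝕜] 𝕜) (C : ℝ) : Prop :=
  ∀ (A B : Finset N) (ε δ : N → 𝕜), (∀ n, ‖ε n‖ = 1) → (∀ n, ‖δ n‖ = 1) →
    ‖∑ n ∈ A, ε n • x n‖ * ‖∑ n ∈ B, δ n • xs n‖ ≤ C * (max A.card B.card : ℕ)

/-- The basis is `C`-bidemocratic with respect to the gauge `ν` (the dual system carries
the corresponding dual norm). -/
def BidemocraticWith (ν : X → ℝ) (x : N → X) (xs : N → X →L[𝕜] 𝕜) (C : ℝ) : Prop :=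
  ∀ (A B : Finset N) (ε δ : N → 𝕜), (∀ n, ‖ε n‖ = 1) → (∀ n, ‖δ n‖ = 1) →
    ν (∑ n ∈ A, ε n • x n) * dualNormWith ν (∑ n ∈ B, δ n • xs n) ≤
      C * (max A.card B.card : ℕ)

/-- Property (A) with respect to the gauge `ν`. -/
def PropertyAWith (ν : X → ℝ) (x : N → X) (xs : N → X →L[𝕜] 𝕜) : Prop :=
  ∀ (A B : Finset N) (ε δ : N → 𝕜) (g : X),
    A.card ≤ B.card → Disjoint A B → (∀ n, ‖ε n‖ = 1) → (∀ n, ‖δ n‖ = 1) →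
    (∀ n, (n ∈ A ∨ n ∈ B) → xs n g = 0) → (∀ n, ‖xs n g‖ ≤ 1) →
    ν ((∑ n ∈ A, ε n • x n) + g) ≤ ν ((∑ n ∈ B, δ n • x n) + g)

end Basis

/-- The basis `x` (indexed by `ℕ`) is `C`-subsymmetric with respect to the gauge `ν`:
every "dilated sign change" extends to an isomorphism onto its range with distortion
constants at most `C`. -/
def SubsymWith (𝕜 : Type*) [RCLike 𝕜] {X : Type*} [NormedAddCommGroup X]
    [NormedSpace 𝕜 X] (ν : X → ℝ) (x : ℕ → X) (C : ℝ) : Prop :=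
  ∀ (lam : ℕ → 𝕜), (∀ n, ‖lam n‖ = 1) → ∀ β : ℕ → ℕ, StrictMono β →
    ∃ T : X →L[𝕜] X, (∀ n, T (x n) = lam n • x (β n)) ∧
      (∀ f : X, ν (T f) ≤ C * ν f) ∧ (∀ f : X, ν f ≤ C * ν (T f))

/-- `X` has nontrivial Rademacher cotype. -/
def NontrivialCotype (X : Type*) [SeminormedAddCommGroup X] : Prop :=
  ∃ q C : ℝ, 0 < q ∧ 0 < C ∧ ∀ (n : ℕ) (f : Fin n → X),
    (∑ i, ‖f i‖ ^ q) ^ (1 / q) ≤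
      C * (((2 : ℝ) ^ n)⁻¹ * ∑ ε : Fin n → Bool, ‖∑ i, (if ε i then f i else -f i)‖)

/-- `X` has nontrivial Rademacher type. -/
def NontrivialType (X : Type*) [SeminormedAddCommGroup X] : Prop :=
  ∃ p C : ℝ, 1 < p ∧ 0 < C ∧ ∀ (n : ℕ) (f : Fin n → X),
    ((2 : ℝ) ^ n)⁻¹ * ∑ ε : Fin n → Bool, ‖∑ i, (if ε i then f i else -f i)‖ ≤
      C * (∑ i, ‖f i‖ ^ p) ^ (1 / p)

end GreedyRenorm
namespace GreedyRenorm

/-! ### Power weights -/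

/-- The weight `d ^ (α - 1)`, with the value `1` at `d = 0`. -/
def powWeight (α : ℝ) (d : ℕ) : ℝ := (max (d : ℝ) 1) ^ (α - 1)

lemma powWeight_pos (α : ℝ) (d : ℕ) : 0 < powWeight α d := by
  unfold powWeight; positivity

lemma powWeight_of_one_le (α : ℝ) {d : ℕ} (hd : 1 ≤ d) :
    powWeight α d = (d : ℝ) ^ (α - 1) := by
  unfold powWeight
  rw [max_eq_left (by exact_mod_cast hd)]

lemma powWeight_anti {α : ℝ} (hα1 : α < 1) {d e : ℕ} (h : d ≤ e) :
    powWeight α e ≤ powWeight α d := by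
  unfold powWeight
  apply Real.rpow_le_rpow_of_nonpos (by positivity) _ (by linarith)
  have : (d : ℝ) ≤ e := by exact_mod_cast h
  exact max_le_max this le_rfl

lemma mul_powWeight {α : ℝ} (hα0 : 0 < α) (d : ℕ) : (d : ℝ) * powWeight α d = (d : ℝ) ^ α := by
  rcases Nat.eq_zero_or_pos d with rfl | hd
  · simp [Real.zero_rpow hα0.ne']
  · have hd' : (0 : ℝ) < d := by exact_mod_cast hd
    rw [powWeight_of_one_le α hd, Real.rpow_sub_one hd'.ne']
    field_simp

/-- A Bernoulli-type lower bound for the increments of a concave power. -/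
lemma mul_rpow_sub_one_le_rpow_sub {α a b : ℝ} (hα0 : 0 < α) (hα1 : α < 1) (ha : 0 ≤ a)
    (hb : 0 < b) : α * ((b - a) * b ^ (α - 1)) ≤ b ^ α - a ^ α := by
  have hab : 0 ≤ a / b := by positivity
  have h := rpow_one_add_le_one_add_mul_self (s := a / b - 1) (by linarith) hα0.le hα1.le
  rw [add_sub_cancel, Real.div_rpow ha hb.le, div_le_iff₀ (by positivity)] at h
  rw [Real.rpow_sub_one hb.ne']
  have : (1 + α * (a / b - 1)) * b ^ α = b ^ α - α * ((b - a) * (b ^ α / b)) := by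
    field_simp
    ring
  linarith

lemma half_mul_powWeight_le_rpow_add_sub {α : ℝ} (hα0 : 0 < α) (hα1 : α < 1) (d j : ℕ)
    (hj : 1 ≤ j) :
    α / 2 * (j * powWeight α (max d j)) ≤ ((d + j : ℕ) : ℝ) ^ α - (d : ℝ) ^ α := by
  have hj' : (1 : ℝ) ≤ j := by exact_mod_cast hj
  have hd : (0 : ℝ) ≤ d := by positivity
  have hM : 1 ≤ max d j := le_max_of_le_right hj
  have hM' : (0 : ℝ) < (max d j : ℕ) := by exact_mod_cast hM
  have h := mul_rpow_sub_one_le_rpow_sub hα0 hα1 hd (b := ((d + j : ℕ) : ℝ))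
    (by push_cast; linarith)
  refine le_trans ?_ h
  have hsub : ((d + j : ℕ) : ℝ) - d = j := by push_cast; ring
  rw [hsub, powWeight_of_one_le α hM]
  have h1 : (2 * ((max d j : ℕ) : ℝ)) ^ (α - 1) ≤ ((d + j : ℕ) : ℝ) ^ (α - 1) := by
    apply Real.rpow_le_rpow_of_nonpos (by push_cast; linarith) _ (by linarith)
    have : d + j ≤ 2 * max d j := by omega
    exact_mod_cast this
  rw [Real.mul_rpow (by norm_num) hM'.le] at h1
  have h2 : (1 / 2 : ℝ) ≤ 2 ^ (α - 1) := by
    have := Real.rpow_le_rpow_of_exponent_le (x := 2) (by norm_num) (show (-1 : ℝ) ≤ α - 1 by linarith)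
    rw [Real.rpow_neg_one] at this
    linarith
  have h3 : 1 / 2 * ((max d j : ℕ) : ℝ) ^ (α - 1) ≤ ((d + j : ℕ) : ℝ) ^ (α - 1) :=
    le_trans (by gcongr) h1
  calc α / 2 * (j * ((max d j : ℕ) : ℝ) ^ (α - 1))
      = α * (j * (1 / 2 * ((max d j : ℕ) : ℝ) ^ (α - 1))) := by ring
    _ ≤ _ := by gcongr

/-! ### Exchanging coordinates in discrete weighted sums -/

section Exchange

variable {N : Type*} {α η : ℝ}

/-- The gauge `u ↦ |D| ^ (α - 1) ∑_{n ∈ D} u n + ∑_{n ∈ E} h n * u n`. -/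
def mixedSum (α : ℝ) (D E : Finset N) (h u : N → ℝ) : ℝ :=
  powWeight α D.card * ∑ n ∈ D, u n + ∑ n ∈ E, h n * u n

lemma mixedSum_mono {D E : Finset N} {h u v : N → ℝ} (hh : ∀ n, 0 ≤ h n) (huv : ∀ n, u n ≤ v n) :
    mixedSum α D E h u ≤ mixedSum α D E h v := by
  have := (powWeight_pos α D.card).le
  unfold mixedSum
  gcongr with n _ n _
  · exact huv n
  · exact hh n
  · exact huv n

lemma mixedSum_add (D E : Finset N) (h u v : N → ℝ) :
    mixedSum α D E h (fun n => u n + v n) = mixedSum α D E h u + mixedSum α D E h v := by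
  simp only [mixedSum, Finset.sum_add_distrib, mul_add]
  ring

lemma mixedSum_const_mul (D E : Finset N) (h u : N → ℝ) (c : ℝ) :
    mixedSum α D E h (fun n => c * u n) = c * mixedSum α D E h u := by
  simp only [mixedSum, mul_left_comm _ c, ← Finset.mul_sum]
  ring

lemma mixedSum_nonneg {D E : Finset N} {h u : N → ℝ} (hh : ∀ n, 0 ≤ h n) (hu : ∀ n, 0 ≤ u n) :
    0 ≤ mixedSum α D E h u :=
  add_nonneg (mul_nonneg (powWeight_pos _ _).le (Finset.sum_nonneg fun n _ => hu n))
    (Finset.sum_nonneg fun n _ => mul_nonneg (hh n) (hu n))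

variable {E : Finset N} {h : N → ℝ}

lemma sum_le_of_card_le_add (hα0 : 0 < α) (hη : 0 ≤ η) {d i j : ℕ}
    (hle : ∀ n ∈ E, h n ≤ η * powWeight α d)
    (hsum : ∀ F ⊆ E, ∑ n ∈ F, h n ≤ η * (F.card : ℝ) ^ α)
    {F : Finset N} (hF : F ⊆ E) (hcard : F.card ≤ i + j) :
    ∑ n ∈ F, h n ≤ η * (i * powWeight α d) + η * (j * powWeight α (max d j)) := by
  classical
  have hbd : ∀ G ⊆ E, ∀ m : ℕ, G.card ≤ m → ∑ n ∈ G, h n ≤ η * (m * powWeight α d) := by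
    intro G hG m hm
    have hw := (powWeight_pos α d).le
    calc ∑ n ∈ G, h n ≤ ∑ n ∈ G, η * powWeight α d := Finset.sum_le_sum fun n hn => hle n (hG hn)
      _ = η * (G.card * powWeight α d) := by rw [Finset.sum_const, nsmul_eq_mul]; ring
      _ ≤ _ := by gcongr
  rcases le_total j d with hjd | hdj
  · rw [max_eq_left hjd, ← mul_add, ← add_mul]
    exact_mod_cast hbd F hF (i + j) hcard
  · rw [max_eq_right hdj, mul_powWeight hα0]
    obtain ⟨G, hGF, hG⟩ := Finset.exists_subset_card_eq (s := F) (n := min j F.card)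
      (min_le_right _ _)
    rw [← Finset.sum_sdiff hGF]
    refine add_le_add (hbd _ (Finset.sdiff_subset.trans hF) i ?_) ?_
    · rw [Finset.card_sdiff_of_subset hGF]; omega
    · refine (hsum G (hGF.trans hF)).trans ?_
      have : (G.card : ℝ) ≤ j := by rw [hG]; exact_mod_cast min_le_left _ _
      gcongr

lemma sum_sub_min_le (hα0 : 0 < α) (hα1 : α < 1) (hη : 0 < η) {d j : ℕ} (hj : 1 ≤ j)
    (hle : ∀ n ∈ E, h n ≤ η * powWeight α d)
    (hsum : ∀ F ⊆ E, ∑ n ∈ F, h n ≤ η * (F.card : ℝ) ^ α) :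
    ∑ n ∈ E, (h n - min (h n) (η * powWeight α (d + j))) ≤
      2 * (η * (j * powWeight α (max d j))) := by
  classical
  set F := E.filter fun n => η * powWeight α (d + j) < h n with hFdef
  have hFE : F ⊆ E := Finset.filter_subset _ _
  have hdj : 1 ≤ d + j := by omega
  have hdj' : (0 : ℝ) < ((d + j : ℕ) : ℝ) := by exact_mod_cast hdj
  have hFlt : ∀ n ∈ F, η * powWeight α (d + j) < h n := fun n hn => (Finset.mem_filter.1 hn).2
  have hcard : F.card ≤ d + j := by
    by_contra! hlt
    have hFpos : 1 ≤ F.card := by omega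
    have h1 : F.card * (η * powWeight α (d + j)) ≤ η * (F.card : ℝ) ^ α := by
      refine le_trans ?_ (hsum F hFE)
      rw [← nsmul_eq_mul]
      exact Finset.card_nsmul_le_sum _ _ _ fun n hn => (hFlt n hn).le
    rw [← mul_powWeight hα0, powWeight_of_one_le α hdj, powWeight_of_one_le α hFpos] at h1
    have h2 : (F.card : ℝ) ^ (α - 1) < ((d + j : ℕ) : ℝ) ^ (α - 1) :=
      Real.rpow_lt_rpow_of_neg hdj' (by exact_mod_cast hlt) (by linarith)
    have h3 : (0 : ℝ) < F.card := by exact_mod_cast hFpos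
    have h4 : η * (F.card * (F.card : ℝ) ^ (α - 1)) <
      η * (F.card * ((d + j : ℕ) : ℝ) ^ (α - 1)) := by gcongr
    linarith
  have hEF : ∑ n ∈ E, (h n - min (h n) (η * powWeight α (d + j))) =
      ∑ n ∈ F, (h n - η * powWeight α (d + j)) := by
    rw [hFdef, Finset.sum_filter]
    refine Finset.sum_congr rfl fun n _ => ?_
    split_ifs with hn
    · rw [min_eq_right hn.le]
    · rw [min_eq_left (not_lt.1 hn), sub_self]
  have hjw : 0 ≤ η * (j * powWeight α (max d j)) := by
    have := powWeight_pos α (max d j)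
    positivity
  rw [hEF]
  rcases le_total j d with hjd | hdj'
  · rw [max_eq_left hjd] at hjw ⊢
    have hw : 0 ≤ η * powWeight α d - η * powWeight α (d + j) := by
      rw [← mul_sub]
      exact mul_nonneg hη.le (sub_nonneg.2 (powWeight_anti hα1 (by omega)))
    have hc : (F.card : ℝ) ≤ ((d + j : ℕ) : ℝ) := by exact_mod_cast hcard
    have hmono : (d : ℝ) ^ α ≤ ((d + j : ℕ) : ℝ) ^ α := by
      apply Real.rpow_le_rpow (by positivity) _ hα0.le
      push_cast; linarith [show (0 : ℝ) ≤ j by positivity]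
    have hmono' := mul_le_mul_of_nonneg_left hmono hη.le
    rw [← mul_powWeight hα0 d, ← mul_powWeight hα0 (d + j)] at hmono'
    calc ∑ n ∈ F, (h n - η * powWeight α (d + j))
        ≤ ∑ n ∈ F, (η * powWeight α d - η * powWeight α (d + j)) :=
          Finset.sum_le_sum fun n hn => sub_le_sub_right (hle n (hFE hn)) _
      _ = F.card * (η * powWeight α d - η * powWeight α (d + j)) := by
          rw [Finset.sum_const, nsmul_eq_mul]
      _ ≤ ((d + j : ℕ) : ℝ) * (η * powWeight α d - η * powWeight α (d + j)) := by gcongr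
      _ ≤ η * (j * powWeight α d) := by push_cast at hmono' ⊢; linarith
      _ ≤ _ := by linarith
  · rw [max_eq_right hdj', mul_powWeight hα0]
    calc ∑ n ∈ F, (h n - η * powWeight α (d + j)) ≤ ∑ n ∈ F, h n := by
          refine Finset.sum_le_sum fun n _ => ?_
          have := powWeight_pos α (d + j)
          linarith [mul_pos hη this]
      _ ≤ η * (F.card : ℝ) ^ α := hsum F hFE
      _ ≤ η * (2 * (j : ℝ)) ^ α := by
          gcongr
          have : F.card ≤ 2 * j := by omega
          exact_mod_cast this
      _ ≤ η * (2 * (j : ℝ) ^ α) := by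
          rw [Real.mul_rpow (by norm_num) (by positivity)]
          gcongr
          exact Real.rpow_le_self_of_one_le (by norm_num) hα1.le
      _ = _ := by ring

lemma mixedSum_indicator_le (hα0 : 0 < α) (hα1 : α < 1) (hη : 0 < η) (hηα : 6 * η ≤ α)
    {D : Finset N} (hDE : Disjoint D E) (hpos : ∀ n, 0 ≤ h n)
    (hle : ∀ n ∈ E, h n ≤ η * powWeight α D.card)
    (hsum : ∀ F ⊆ E, ∑ n ∈ F, h n ≤ η * (F.card : ℝ) ^ α) (A : Finset N) {u : N → ℝ}
    (hu : ∀ n ∈ A, u n ≤ 1) (hu' : ∀ n ∉ A, u n = 0) :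
    mixedSum α D E h u ≤ (A.card : ℝ) ^ α := by
  classical
  have hD : ∑ n ∈ D, u n ≤ (D ∩ A).card := by
    rw [← Finset.sum_inter_add_sum_sdiff D A, Finset.card_eq_sum_ones, Nat.cast_sum]
    rw [Finset.sum_eq_zero (s := D \ A) fun n hn => hu' n (Finset.mem_sdiff.1 hn).2, add_zero]
    exact Finset.sum_le_sum fun n hn => by simpa using hu n (Finset.mem_inter.1 hn).2
  have hE : ∑ n ∈ E, h n * u n ≤ ∑ n ∈ E ∩ A, h n := by
    rw [← Finset.sum_inter_add_sum_sdiff E A]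
    rw [Finset.sum_eq_zero (s := E \ A) fun n hn => by
      rw [hu' n (Finset.mem_sdiff.1 hn).2, mul_zero], add_zero]
    exact Finset.sum_le_sum fun n hn =>
      mul_le_of_le_one_right (hpos n) (hu n (Finset.mem_inter.1 hn).2)
  have hcard : (D ∩ A).card + (E ∩ A).card ≤ A.card := by
    rw [← Finset.card_union_of_disjoint
      (hDE.mono Finset.inter_subset_left Finset.inter_subset_left)]
    exact Finset.card_le_card (Finset.union_subset Finset.inter_subset_right
      Finset.inter_subset_right)
  set p := (D ∩ A).card with hp
  set k := (E ∩ A).card with hk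
  have hpw : powWeight α D.card ≤ powWeight α p :=
    powWeight_anti hα1 (Finset.card_le_card Finset.inter_subset_left)
  have hw : powWeight α D.card * ∑ n ∈ D, u n ≤ (p : ℝ) ^ α := by
    rw [← mul_powWeight hα0, mul_comm (p : ℝ)]
    have := (powWeight_pos α D.card).le
    have := (powWeight_pos α p).le
    exact (mul_le_mul_of_nonneg_left hD (powWeight_pos α D.card).le).trans (by gcongr)
  have hpk : ((p + k : ℕ) : ℝ) ^ α ≤ (A.card : ℝ) ^ α := by
    gcongr
  refine le_trans ?_ hpk
  unfold mixedSum
  rcases Nat.eq_zero_or_pos k with h0 | h1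
  · have : E ∩ A = ∅ := Finset.card_eq_zero.1 h0
    rw [this, Finset.sum_empty] at hE
    rw [h0, add_zero]
    linarith
  · have h2 := half_mul_powWeight_le_rpow_add_sub hα0 hα1 p k h1
    have h3 := sum_le_of_card_le_add (d := p) (i := 0) (j := k) hα0 hη.le
      (fun n hn => (hle n hn).trans (by gcongr)) hsum (F := E ∩ A)
      Finset.inter_subset_left (by omega)
    have h4 : η * (k * powWeight α (max p k)) ≤ α / 2 * (k * powWeight α (max p k)) := by
      have := powWeight_pos α (max p k)
      gcongr
      linarith
    push_cast at h3
    linarith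

/-- The exchange lemma: the coordinates of `u` on `A`, which are at most `t`, can be traded for
coordinates on a set `B` of the same size on which `y` is at least `t`. -/
lemma exists_mixedSum_le (hα0 : 0 < α) (hα1 : α < 1) (hη : 0 < η) (hηα : 6 * η ≤ α)
    {D : Finset N} (hDE : Disjoint D E) (hpos : ∀ n, 0 ≤ h n)
    (hle : ∀ n ∈ E, h n ≤ η * powWeight α D.card)
    (hsum : ∀ F ⊆ E, ∑ n ∈ F, h n ≤ η * (F.card : ℝ) ^ α)
    {A B : Finset N} (hAB : Disjoint A B) (hcard : A.card = B.card) {u y : N → ℝ} {t : ℝ}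
    (hu0 : ∀ n, 0 ≤ u n) (hut : ∀ n, u n ≤ t) (huB : ∀ n ∈ B, u n = 0)
    (hyB : ∀ n ∈ B, t ≤ y n) (huy : ∀ n ∉ A, u n ≤ y n) :
    ∃ (D' E' : Finset N) (h' : N → ℝ), Disjoint D' E' ∧ E' ⊆ E ∧ (∀ n, 0 ≤ h' n) ∧
      (∀ n, h' n ≤ h n) ∧ (∀ n ∈ E', h' n ≤ η * powWeight α D'.card) ∧
      mixedSum α D E h u ≤ mixedSum α D' E' h' y := by
  classical
  set D₀ := D \ (A ∪ B) with hD₀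
  set E' := E \ (A ∪ B) with hE'
  have hD₀B : Disjoint D₀ B := by
    rw [hD₀]; exact Finset.disjoint_of_subset_right Finset.subset_union_right Finset.sdiff_disjoint
  have hD'E' : Disjoint (D₀ ∪ B) E' := by
    rw [Finset.disjoint_left] at hDE ⊢
    intro n hn hn'
    simp only [hD₀, hE', Finset.mem_union, Finset.mem_sdiff] at hn hn'
    grind
  have hE'E : E' ⊆ E := Finset.sdiff_subset
  have hdcard : D.card = D₀.card + (D ∩ A).card + (D ∩ B).card := by
    have h1 : (D ∩ (A ∪ B)).card = (D ∩ A).card + (D ∩ B).card := by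
      rw [Finset.inter_union_distrib_left, Finset.card_union_of_disjoint
        (hAB.mono Finset.inter_subset_right Finset.inter_subset_right)]
    have h2 := Finset.card_sdiff_add_card_inter D (A ∪ B)
    rw [← hD₀] at h2
    omega
  have hd'card : (D₀ ∪ B).card = D₀.card + B.card := Finset.card_union_of_disjoint hD₀B
  have hEA : (E ∩ A).card + (D ∩ A).card ≤ A.card := by
    rw [← Finset.card_union_of_disjoint
      (hDE.symm.mono Finset.inter_subset_left Finset.inter_subset_left)]
    exact Finset.card_le_card (Finset.union_subset Finset.inter_subset_right
      Finset.inter_subset_right)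
  have hsplit : ∀ (G : Finset N) (v : N → ℝ), (∀ n ∈ B, v n = 0) →
      ∑ n ∈ G, v n = ∑ n ∈ G \ (A ∪ B), v n + ∑ n ∈ G ∩ A, v n := by
    intro G v hv
    rw [← Finset.sum_inter_add_sum_sdiff G (A ∪ B), add_comm, Finset.inter_union_distrib_left,
      Finset.sum_union (hAB.mono Finset.inter_subset_right Finset.inter_subset_right),
      Finset.sum_eq_zero (s := G ∩ B) fun n hn => hv n (Finset.mem_inter.1 hn).2, add_zero]
  have ht : 0 ≤ t ∨ IsEmpty N := by
    rcases isEmpty_or_nonempty N with hN | ⟨⟨n⟩⟩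
    · exact Or.inr hN
    · exact Or.inl ((hu0 n).trans (hut n))
  rcases ht with ht | hN
  swap
  · exact ⟨D, E, h, hDE, subset_rfl, hpos, fun n => le_rfl, hle,
      mixedSum_mono hpos fun n => (hN.false n).elim⟩
  have hDA : ∑ n ∈ D ∩ A, u n ≤ t * (D ∩ A).card := by
    rw [mul_comm, ← nsmul_eq_mul]; exact Finset.sum_le_card_nsmul _ _ _ fun n _ => hut n
  have hD₀t : ∑ n ∈ D₀, u n ≤ t * D₀.card := by
    rw [mul_comm, ← nsmul_eq_mul]; exact Finset.sum_le_card_nsmul _ _ _ fun n _ => hut n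
  have hEAt : ∑ n ∈ E ∩ A, h n * u n ≤ t * ∑ n ∈ E ∩ A, h n := by
    rw [Finset.mul_sum]
    refine Finset.sum_le_sum fun n _ => ?_
    rw [mul_comm t]
    exact mul_le_mul_of_nonneg_left (hut n) (hpos n)
  have hyD' : ∑ n ∈ D₀, u n + t * B.card ≤ ∑ n ∈ D₀ ∪ B, y n := by
    rw [Finset.sum_union hD₀B]
    refine add_le_add (Finset.sum_le_sum fun n hn => huy n ?_) ?_
    · simp only [hD₀, Finset.mem_sdiff, Finset.mem_union, not_or] at hn; exact hn.2.1
    · rw [mul_comm, ← nsmul_eq_mul]; exact Finset.card_nsmul_le_sum _ _ _ hyB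
  have hyE' : ∀ n ∈ E', u n ≤ y n := by
    intro n hn
    simp only [hE', Finset.mem_sdiff, Finset.mem_union, not_or] at hn
    exact huy n hn.2.1
  have hval : mixedSum α D E h u ≤ powWeight α D.card * (∑ n ∈ D₀, u n + t * (D ∩ A).card) +
      (∑ n ∈ E', h n * u n + t * ∑ n ∈ E ∩ A, h n) := by
    have := (powWeight_pos α D.card).le
    unfold mixedSum
    rw [hsplit D u huB, hsplit E (fun n => h n * u n) fun n hn => by simp [huB n hn]]
    gcongr
  have hw := powWeight_pos α D.card
  have hw' := powWeight_pos α (D₀ ∪ B).card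
  have hη1 : η ≤ 1 := by linarith
  have huD₀ : 0 ≤ ∑ n ∈ D₀, u n := Finset.sum_nonneg fun n _ => hu0 n
  have hEA' : ((E ∩ A).card : ℝ) + (D ∩ A).card ≤ B.card := by rw [← hcard]; exact_mod_cast hEA
  rcases le_or_gt A.card ((D ∩ A).card + (D ∩ B).card) with hcase | hcase
  · refine ⟨D₀ ∪ B, E', h, hD'E', hE'E, hpos, fun n => le_rfl, ?_, hval.trans ?_⟩
    · intro n hn
      have := powWeight_anti hα1 (show (D₀ ∪ B).card ≤ D.card by omega)
      exact (hle n (hE'E hn)).trans (by gcongr)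
    have hhA : ∑ n ∈ E ∩ A, h n ≤ powWeight α D.card * (E ∩ A).card := by
      rw [mul_comm, ← nsmul_eq_mul]
      refine Finset.sum_le_card_nsmul _ _ _ fun n hn => ?_
      exact (hle n (Finset.inter_subset_left hn)).trans (mul_le_of_le_one_left hw.le hη1)
    have hww := powWeight_anti hα1 (show (D₀ ∪ B).card ≤ D.card by omega)
    have hsumE' : ∑ n ∈ E', h n * u n ≤ ∑ n ∈ E', h n * y n :=
      Finset.sum_le_sum fun n hn => mul_le_mul_of_nonneg_left (hyE' n hn) (hpos n)
    have h1 : powWeight α D.card * (∑ n ∈ D₀, u n + t * B.card) ≤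
        powWeight α (D₀ ∪ B).card * ∑ n ∈ D₀ ∪ B, y n :=
      mul_le_mul hww hyD' (by positivity) hw'.le
    have h2 := mul_le_mul_of_nonneg_left hhA ht
    have h3 := mul_le_mul_of_nonneg_left hEA' (mul_nonneg ht hw.le)
    unfold mixedSum
    linarith
  · obtain ⟨j, hj⟩ : ∃ j, A.card = (D ∩ A).card + (D ∩ B).card + j :=
      ⟨_, (Nat.add_sub_of_le hcase.le).symm⟩
    have hj1 : 1 ≤ j := by omega
    have hd' : (D₀ ∪ B).card = D.card + j := by omega
    have hD'c : (D₀.card : ℝ) + B.card = ((D.card + j : ℕ) : ℝ) := by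
      rw [← hd', hd'card]; push_cast; rfl
    have hhA := sum_le_of_card_le_add hα0 hη.le (i := (D ∩ B).card) (j := j) hle hsum
      (F := E ∩ A) Finset.inter_subset_left (by omega)
    have hloss := sum_sub_min_le hα0 hα1 hη hj1 hle hsum
    have hinc := half_mul_powWeight_le_rpow_add_sub hα0 hα1 D.card j hj1
    rw [← mul_powWeight hα0, ← mul_powWeight hα0] at hinc
    set h' : N → ℝ := fun n => min (h n) (η * powWeight α (D.card + j)) with hh'
    have hh'pos : ∀ n, 0 ≤ h' n := fun n =>
      le_min (hpos n) (mul_nonneg hη.le (powWeight_pos _ _).le)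
    have hh'le : ∀ n, h' n ≤ h n := fun n => min_le_left _ _
    refine ⟨D₀ ∪ B, E', h', hD'E', hE'E, hh'pos, hh'le, ?_, hval.trans ?_⟩
    · intro n _
      rw [hd']; exact min_le_right _ _
    have hE'u : ∑ n ∈ E', h n * u n ≤
        ∑ n ∈ E', h' n * y n + t * (2 * (η * (j * powWeight α (max D.card j)))) := by
      calc ∑ n ∈ E', h n * u n ≤ ∑ n ∈ E', (h' n * y n + t * (h n - h' n)) := by
            refine Finset.sum_le_sum fun n hn => ?_
            have h1 := mul_le_mul_of_nonneg_left (hyE' n hn) (hh'pos n)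
            have h2 := mul_le_mul_of_nonneg_left (hut n) (sub_nonneg.2 (hh'le n))
            linarith
        _ = ∑ n ∈ E', h' n * y n + t * ∑ n ∈ E', (h n - h' n) := by
            rw [Finset.sum_add_distrib, Finset.mul_sum]
        _ ≤ ∑ n ∈ E', h' n * y n + t * ∑ n ∈ E, (h n - h' n) := by
            gcongr
            exact fun n _ _ => sub_nonneg.2 (hh'le n)
        _ ≤ _ := by gcongr
    have hww := powWeight_anti hα1 (show D.card ≤ D.card + j by omega)
    have hjr : (B.card : ℝ) = (D ∩ A).card + (D ∩ B).card + j := by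
      rw [← hcard, hj]; push_cast; rfl
    have hqη : η * ((D ∩ B).card * powWeight α D.card) ≤ (D ∩ B).card * powWeight α D.card :=
      mul_le_of_le_one_left (by positivity) hη1
    have hMη : 3 * (η * (j * powWeight α (max D.card j))) ≤
        α / 2 * (j * powWeight α (max D.card j)) := by
      have := powWeight_pos α (max D.card j)
      rw [← mul_assoc]
      gcongr
      linarith
    have hy' := mul_le_mul_of_nonneg_left hyD' hw'.le
    rw [hd'] at hy'
    unfold mixedSum
    rw [hd']
    have hS : ∑ n ∈ D₀, u n + t * B.card ≤ t * ((D.card + j : ℕ) : ℝ) := by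
      rw [← hD'c]; linarith
    have hSw := mul_le_mul_of_nonneg_left hS (sub_nonneg.2 hww)
    have htA := mul_le_mul_of_nonneg_left hhA ht
    have htq := mul_le_mul_of_nonneg_left hqη ht
    have htM := mul_le_mul_of_nonneg_left (hMη.trans hinc) ht
    rw [hjr] at hy' hSw
    push_cast at hSw htM
    linarith

end Exchange

/-! ### Greedy bases: unconditionality and democracy -/

lemma powWeight_mul_rpow_le_one {α : ℝ} (hα1 : α < 1) (d : ℕ) :
    powWeight α d * (d : ℝ) ^ (1 - α) ≤ 1 := by
  rcases Nat.eq_zero_or_pos d with rfl | hd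
  · rw [Nat.cast_zero, Real.zero_rpow (by linarith), mul_zero]
    exact zero_le_one
  · have hd' : (0 : ℝ) < d := by exact_mod_cast hd
    rw [powWeight_of_one_le α hd, ← Real.rpow_add hd']
    simp

lemma sum_abs_le_two_mul {N : Type*} {A : Finset N} {z : N → ℝ} {M : ℝ}
    (hM : ∀ F ⊆ A, |∑ n ∈ F, z n| ≤ M) : ∑ n ∈ A, |z n| ≤ 2 * M := by
  classical
  rw [← Finset.sum_filter_add_sum_filter_not A (fun n => 0 ≤ z n)]
  have h1 : ∑ n ∈ A with 0 ≤ z n, |z n| ≤ M := by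
    rw [Finset.sum_congr rfl fun n hn => abs_of_nonneg (Finset.mem_filter.1 hn).2]
    exact (le_abs_self _).trans (hM _ (Finset.filter_subset _ _))
  have h2 : ∑ n ∈ A with ¬ 0 ≤ z n, |z n| ≤ M := by
    rw [Finset.sum_congr rfl fun n hn => abs_of_neg (not_le.1 (Finset.mem_filter.1 hn).2),
      Finset.sum_neg_distrib]
    exact (neg_le_abs _).trans (hM _ (Finset.filter_subset _ _))
  linarith

lemma norm_le_abs_re_add_abs_im {𝕜 : Type*} [RCLike 𝕜] (z : 𝕜) :
    ‖z‖ ≤ |RCLike.re z| + |RCLike.im z| := by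
  refine (pow_le_pow_iff_left₀ (norm_nonneg z) (by positivity) two_ne_zero).1 ?_
  rw [RCLike.norm_sq_eq_def]
  nlinarith [abs_nonneg (RCLike.re z), abs_nonneg (RCLike.im z), sq_abs (RCLike.re z),
    sq_abs (RCLike.im z), mul_nonneg (abs_nonneg (RCLike.re z)) (abs_nonneg (RCLike.im z))]

lemma sum_norm_le_four_mul {𝕜 : Type*} [RCLike 𝕜] {N : Type*} {A : Finset N} {z : N → 𝕜} {M : ℝ}
    (hM : ∀ F ⊆ A, ‖∑ n ∈ F, z n‖ ≤ M) : ∑ n ∈ A, ‖z n‖ ≤ 4 * M := by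
  have hre : ∑ n ∈ A, |RCLike.re (z n)| ≤ 2 * M := sum_abs_le_two_mul fun F hF => by
    rw [← map_sum]; exact (RCLike.abs_re_le_norm _).trans (hM F hF)
  have him : ∑ n ∈ A, |RCLike.im (z n)| ≤ 2 * M := sum_abs_le_two_mul fun F hF => by
    rw [← map_sum]; exact (RCLike.abs_im_le_norm _).trans (hM F hF)
  calc ∑ n ∈ A, ‖z n‖ ≤ ∑ n ∈ A, (|RCLike.re (z n)| + |RCLike.im (z n)|) :=
        Finset.sum_le_sum fun n _ => norm_le_abs_re_add_abs_im (z n)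
    _ ≤ 4 * M := by rw [Finset.sum_add_distrib]; linarith

section GreedyBasis

variable {𝕜 : Type*} [RCLike 𝕜] {N : Type*} {X : Type*} [NormedAddCommGroup X]
  [NormedSpace 𝕜 X] {x : N → X} {xs : N → X →L[𝕜] 𝕜}

open Classical in
lemma IsBasis.coord_sum (hb : IsBasis x xs) (A : Finset N) (a : N → 𝕜) (k : N) :
    xs k (∑ n ∈ A, a n • x n) = if k ∈ A then a k else 0 := by
  rw [map_sum]
  have : ∀ n ∈ A, xs k (a n • x n) = if k = n then a n else 0 := by
    intro n _
    rw [map_smul, smul_eq_mul]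
    split_ifs with h
    · rw [h, hb.biorth_diag, mul_one]
    · rw [hb.biorth_off k n h, mul_zero]
  rw [Finset.sum_congr rfl this, Finset.sum_ite_eq]

lemma IsBasis.coord_sum_of_mem (hb : IsBasis x xs) {A : Finset N} (a : N → 𝕜) {k : N}
    (hk : k ∈ A) : xs k (∑ n ∈ A, a n • x n) = a k := by
  rw [hb.coord_sum, if_pos hk]

lemma IsBasis.coord_sum_of_notMem (hb : IsBasis x xs) {A : Finset N} (a : N → 𝕜) {k : N}
    (hk : k ∉ A) : xs k (∑ n ∈ A, a n • x n) = 0 := by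
  rw [hb.coord_sum, if_neg hk]

lemma IsBasis.exists_norm_coord_le (hb : IsBasis x xs) :
    ∃ K : ℝ, ∀ n f, ‖xs n f‖ ≤ K * ‖f‖ := by
  obtain ⟨c, hc, hcx⟩ := hb.norm_pos
  obtain ⟨M, hM⟩ := hb.mBounded
  refine ⟨M / c, fun n f => ((xs n).le_opNorm f).trans ?_⟩
  gcongr
  rw [le_div_iff₀ hc, mul_comm]
  exact (mul_le_mul_of_nonneg_right (hcx n) (norm_nonneg _)).trans (hM n)

/-- Greedy bases are suppression unconditional. -/
lemma GreedyWith.norm_greedyProj_le {C : ℝ} (hb : IsBasis x xs)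
    (hg : GreedyWith (fun f : X => ‖f‖) x xs C) (A : Finset N) (f : X) :
    ‖greedyProj x xs A f‖ ≤ (C + 1) * ‖f‖ := by
  obtain ⟨K, hK⟩ := hb.exists_norm_coord_le
  set l : 𝕜 := ((K * ‖f‖ : ℝ) : 𝕜) with hl
  set g : X := f - ∑ n ∈ A, (xs n f - l) • x n with hgdef
  have hgA : ∀ n ∈ A, xs n g = l := fun n hn => by
    rw [hgdef, map_sub, hb.coord_sum_of_mem _ hn]; ring
  have hgA' : ∀ n ∉ A, xs n g = xs n f := fun n hn => by
    rw [hgdef, map_sub, hb.coord_sum_of_notMem _ hn, sub_zero]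
  have hgr : GreedySet xs g A := by
    intro n hn k hk
    rw [hgA n hn, hgA' k hk, hl, RCLike.norm_ofReal]
    exact (hK k f).trans (le_abs_self _)
  have h := hg g A A (fun n => l - xs n f) hgr le_rfl
  have h1 : g - greedyProj x xs A g = f - greedyProj x xs A f := by
    have : greedyProj x xs A g = ∑ n ∈ A, l • x n :=
      Finset.sum_congr rfl fun n hn => by rw [hgA n hn]
    rw [this, hgdef, greedyProj]
    simp only [sub_smul, Finset.sum_sub_distrib]
    abel
  have h2 : g - ∑ n ∈ A, (l - xs n f) • x n = f := by
    rw [hgdef]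
    simp only [sub_smul, Finset.sum_sub_distrib]
    abel
  simp only [h1, h2] at h
  have h3 : greedyProj x xs A f = f - (f - greedyProj x xs A f) := by abel
  rw [h3]
  linarith [norm_sub_le f (f - greedyProj x xs A f)]

lemma sum_norm_coord_mul_norm_apply_le {K : ℝ} (hK : ∀ A f, ‖greedyProj x xs A f‖ ≤ K * ‖f‖)
    (A : Finset N) (f : X) (g : StrongDual 𝕜 X) (hg : ‖g‖ ≤ 1) :
    ∑ n ∈ A, ‖xs n f‖ * ‖g (x n)‖ ≤ 4 * K * ‖f‖ := by
  simp only [← norm_mul]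
  rw [mul_assoc]
  refine sum_norm_le_four_mul fun F _ => ?_
  have : ∑ n ∈ F, xs n f * g (x n) = g (greedyProj x xs F f) := by
    simp [greedyProj, map_sum]
  rw [this]
  exact ((g.le_of_opNorm_le hg _).trans_eq (one_mul _)).trans (hK F f)

/-- Suppression unconditional bases are lattice unconditional. -/
lemma latticeUnconditionalWith_norm [Nonempty N] {K : ℝ} (hK : ∀ A f, ‖greedyProj x xs A f‖ ≤ K * ‖f‖) :
    LatticeUnconditionalWith (fun f : X => ‖f‖) x xs (4 * K) := by
  intro f A lam M hM
  obtain ⟨g, hg1, hg⟩ := exists_dual_vector'' 𝕜 (∑ n ∈ A, lam n • xs n f • x n)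
  obtain ⟨n₀⟩ := ‹Nonempty N›
  have hM0 : 0 ≤ M := (norm_nonneg _).trans (hM n₀)
  have h := congrArg (fun z : 𝕜 => ‖z‖) hg
  simp only [RCLike.norm_ofReal, abs_norm, map_sum, map_smul, smul_eq_mul] at h
  calc ‖∑ n ∈ A, lam n • xs n f • x n‖ = ‖∑ n ∈ A, lam n * (xs n f * g (x n))‖ := h.symm
    _ ≤ ∑ n ∈ A, ‖lam n * (xs n f * g (x n))‖ := norm_sum_le _ _
    _ ≤ ∑ n ∈ A, M * (‖xs n f‖ * ‖g (x n)‖) := by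
        refine Finset.sum_le_sum fun n _ => ?_
        rw [norm_mul, norm_mul]
        gcongr
        exact hM n
    _ ≤ M * (4 * K * ‖f‖) := by
        rw [← Finset.mul_sum]
        gcongr
        exact sum_norm_coord_mul_norm_apply_le hK A f g hg1
    _ = _ := by ring

lemma GreedyWith.norm_sum_smul_le {C K : ℝ} (hb : IsBasis x xs)
    (hg : GreedyWith (fun f : X => ‖f‖) x xs C)
    (hK : LatticeUnconditionalWith (fun f : X => ‖f‖) x xs K) {A D : Finset N}
    (hAD : A.card ≤ D.card) {ε : N → 𝕜} (hε : ∀ n, ‖ε n‖ = 1) :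
    ‖∑ n ∈ A, ε n • x n‖ ≤ (K + C) * ‖∑ n ∈ D, x n‖ := by
  classical
  set f := ∑ n ∈ D, x n with hf
  have hf' : f = ∑ n ∈ D, (1 : 𝕜) • x n := by simp [hf]
  have hfD : ∀ n ∈ D, xs n f = 1 := fun n hn => by
    rw [hf', hb.coord_sum_of_mem (fun _ => (1 : 𝕜)) hn]
  have hfD' : ∀ n ∉ D, xs n f = 0 := fun n hn => by
    rw [hf', hb.coord_sum_of_notMem (fun _ => (1 : 𝕜)) hn]
  have h1 : ‖∑ n ∈ A ∩ D, ε n • x n‖ ≤ K * ‖f‖ := by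
    have := hK f (A ∩ D) ε 1 fun n => (hε n).le
    rw [mul_one] at this
    refine le_of_eq_of_le ?_ this
    refine congrArg _ (Finset.sum_congr rfl fun n hn => ?_)
    rw [hfD n (Finset.mem_inter.1 hn).2, one_smul]
  have h2 : ‖∑ n ∈ A \ D, ε n • x n‖ ≤ C * ‖f‖ := by
    set v := ∑ n ∈ A \ D, ε n • x n with hv
    have hvD : ∀ n ∈ D, xs n (v + f) = 1 := fun n hn => by
      rw [map_add, hfD n hn, hv, hb.coord_sum_of_notMem _ (by simp [hn]), zero_add]
    have hvD' : ∀ n ∉ D, ‖xs n (v + f)‖ ≤ 1 := fun n hn => by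
      rw [map_add, hfD' n hn, hv, hb.coord_sum, add_zero]
      split_ifs
      · exact (hε n).le
      · simp
    have hgr : GreedySet xs (v + f) D := fun n hn k hk => by
      rw [hvD n hn, norm_one]; exact hvD' k hk
    have hc : (A \ D).card ≤ D.card := (Finset.card_le_card Finset.sdiff_subset).trans hAD
    have h := hg (v + f) D (A \ D) ε hgr hc
    have hp : greedyProj x xs D (v + f) = f :=
      Finset.sum_congr rfl fun n hn => by rw [hvD n hn, one_smul]
    simpa only [hp, ← hv, add_sub_cancel_right, add_sub_cancel_left] using h
  rw [← Finset.sum_inter_add_sum_sdiff A D]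
  linarith [norm_add_le (∑ n ∈ A ∩ D, ε n • x n) (∑ n ∈ A \ D, ε n • x n)]

lemma EquivSeq.norm_sum_smul_le {α D₀ : ℝ} (hD₀ : 1 ≤ D₀)
    (hD : ∀ m : ℕ, 1 ≤ m → (1 / D₀) * (m : ℝ) ^ α ≤ fundFun 𝕜 x m ∧
      fundFun 𝕜 x m ≤ D₀ * (m : ℝ) ^ α) (A : Finset N) {ε : N → 𝕜} (hε : ∀ n, ‖ε n‖ = 1) :
    ‖∑ n ∈ A, ε n • x n‖ ≤ D₀ * (A.card : ℝ) ^ α := by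
  rcases A.eq_empty_or_nonempty with rfl | hA
  · simp only [Finset.sum_empty, norm_zero]; positivity
  have hA1 : 1 ≤ A.card := Finset.card_pos.2 hA
  have hA' : (0 : ℝ) < A.card := by exact_mod_cast hA1
  refine le_trans ?_ (hD _ hA1).2
  refine le_csSup ?_ ⟨A, ε, le_rfl, hε, rfl⟩
  by_contra hbdd
  have h0 : fundFun 𝕜 x A.card = 0 := Real.sSup_of_not_bddAbove hbdd
  have h1 := (hD _ hA1).1
  rw [h0] at h1
  have : 0 < (1 / D₀) * (A.card : ℝ) ^ α := by positivity
  linarith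

lemma exists_le_norm_sum {α D₀ C : ℝ} (hα0 : 0 < α) (hD₀ : 1 ≤ D₀) (hC : 0 < C)
    (hD : ∀ m : ℕ, 1 ≤ m → (1 / D₀) * (m : ℝ) ^ α ≤ fundFun 𝕜 x m)
    (hC' : ∀ (A D : Finset N) (ε : N → 𝕜), A.card ≤ D.card → (∀ n, ‖ε n‖ = 1) →
      ‖∑ n ∈ A, ε n • x n‖ ≤ C * ‖∑ n ∈ D, x n‖) :
    ∃ c : ℝ, 0 < c ∧ ∀ D : Finset N, c * (D.card : ℝ) ^ α ≤ ‖∑ n ∈ D, x n‖ := by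
  refine ⟨1 / D₀ / C, by positivity, fun D => ?_⟩
  rcases D.eq_empty_or_nonempty with rfl | hne
  · simp [Real.zero_rpow hα0.ne']
  have h : fundFun 𝕜 x D.card ≤ C * ‖∑ n ∈ D, x n‖ := by
    refine csSup_le ⟨_, ∅, fun _ => 1, by simp, by simp, rfl⟩ ?_
    rintro r ⟨A, ε, hA, hε, rfl⟩
    exact hC' A D ε hA hε
  have := (hD _ (Finset.card_pos.2 hne)).trans h
  rw [div_mul_eq_mul_div, div_le_iff₀ hC]
  linarith

/-- The coordinates of a vector belong to weak `ℓ_{1/α}`, hence are summed on finite sets at the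
rate of the dual power. -/
lemma exists_sum_norm_coord_le {α c K : ℝ} (hα0 : 0 < α) (hα1 : α < 1) (hc : 0 < c) (hK0 : 0 ≤ K)
    (hK : LatticeUnconditionalWith (fun f : X => ‖f‖) x xs K)
    (hD : ∀ D : Finset N, c * (D.card : ℝ) ^ α ≤ ‖∑ n ∈ D, x n‖) :
    ∃ L : ℝ, 0 ≤ L ∧ ∀ (D : Finset N) (f : X),
      ∑ n ∈ D, ‖xs n f‖ ≤ L * (D.card : ℝ) ^ (1 - α) * ‖f‖ := by
  classical
  have hα' : 0 < 1 - α := by linarith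
  refine ⟨K / c / (1 - α), by positivity, fun D f => ?_⟩
  generalize hd : D.card = d
  induction d generalizing D with
  | zero =>
    rw [Finset.card_eq_zero.1 hd]
    simp [Real.zero_rpow hα'.ne']
  | succ d ih =>
    obtain ⟨k, hk, hmin⟩ := D.exists_min_image (fun n => ‖xs n f‖)
      (Finset.card_pos.1 (by omega))
    have h1 := ih (D.erase k) (by rw [Finset.card_erase_of_mem hk]; omega)
    rw [← Finset.add_sum_erase D _ hk]
    have h2 : ‖xs k f‖ * ‖∑ n ∈ D, x n‖ ≤ K * ‖f‖ := by
      rcases eq_or_ne (xs k f) 0 with h0 | h0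
      · rw [h0, norm_zero, zero_mul]; positivity
      have hne : ∀ n ∈ D, xs n f ≠ 0 := fun n hn =>
        norm_pos_iff.1 ((norm_pos_iff.2 h0).trans_le (hmin n hn))
      have := hK f D (fun n => if n ∈ D then xs k f / xs n f else 0) 1 fun n => by
        split_ifs with hn
        · rw [norm_div]; exact div_le_one_of_le₀ (hmin n hn) (norm_nonneg _)
        · simp
      rw [mul_one] at this
      rw [← norm_smul, Finset.smul_sum]
      refine le_of_eq_of_le ?_ this
      refine congrArg _ (Finset.sum_congr rfl fun n hn => ?_)
      rw [if_pos hn, smul_smul, div_mul_cancel₀ _ (hne n hn)]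
    have hd1 : (0 : ℝ) < ((d + 1 : ℕ) : ℝ) := by positivity
    have h3 : ‖xs k f‖ * (c * ((d + 1 : ℕ) : ℝ) ^ α) ≤ K * ‖f‖ := by
      refine le_trans ?_ h2
      have := hD D
      rw [hd] at this
      gcongr
    have h4 : ‖xs k f‖ ≤ K / c * ‖f‖ * ((d + 1 : ℕ) : ℝ) ^ (1 - α - 1) := by
      have e : (1 - α - 1 : ℝ) = -α := by ring
      rw [e, Real.rpow_neg hd1.le, ← div_eq_mul_inv, le_div_iff₀ (by positivity),
        div_mul_eq_mul_div, le_div_iff₀ hc]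
      linarith
    have h5 := mul_rpow_sub_one_le_rpow_sub hα' (by linarith) (Nat.cast_nonneg d) hd1
    have e : ((d + 1 : ℕ) : ℝ) - d = 1 := by push_cast; ring
    rw [e, one_mul] at h5
    have h6 : ((d + 1 : ℕ) : ℝ) ^ (1 - α - 1) ≤
        (((d + 1 : ℕ) : ℝ) ^ (1 - α) - (d : ℝ) ^ (1 - α)) / (1 - α) := by
      rw [le_div_iff₀ hα']; linarith
    have h7 : K / c * ‖f‖ * ((d + 1 : ℕ) : ℝ) ^ (1 - α - 1) ≤ K / c * ‖f‖ *
        ((((d + 1 : ℕ) : ℝ) ^ (1 - α) - (d : ℝ) ^ (1 - α)) / (1 - α)) := by gcongr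
    calc ‖xs k f‖ + ∑ n ∈ D.erase k, ‖xs n f‖
        ≤ K / c * ‖f‖ * ((((d + 1 : ℕ) : ℝ) ^ (1 - α) - (d : ℝ) ^ (1 - α)) / (1 - α)) +
          K / c / (1 - α) * (d : ℝ) ^ (1 - α) * ‖f‖ := add_le_add (h4.trans h7) h1
      _ = _ := by field_simp; ring

end GreedyBasis

/-! ### The renorming -/

section Renorming

variable {𝕜 : Type*} [RCLike 𝕜] {N : Type*} {X : Type*} [NormedAddCommGroup X]
  [NormedSpace 𝕜 X] {x : N → X} {xs : N → X →L[𝕜] 𝕜} {α η δ : ℝ}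

/-- Data for the functionals norming the new norm: a set `D` carrying the weight
`|D| ^ (α - 1)`, and weights `h` on a disjoint set `E` which are small relative to the one on `D`
and form a functional of lattice norm at most `δ`. -/
structure IsAdmissible (xs : N → X →L[𝕜] 𝕜) (α η δ : ℝ) (D E : Finset N) (h : N → ℝ) : Prop where
  disj : Disjoint D E
  nonneg : ∀ n, 0 ≤ h n
  le_weight : ∀ n ∈ E, h n ≤ η * powWeight α D.card
  sum_le : ∀ f : X, ∑ n ∈ E, h n * ‖xs n f‖ ≤ δ * ‖f‖

lemma isAdmissible_empty_right (hδ : 0 ≤ δ) (D : Finset N) :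
    IsAdmissible xs α η δ D ∅ 0 where
  disj := Finset.disjoint_empty_right D
  nonneg _ := le_rfl
  le_weight := by simp
  sum_le f := by simp only [Finset.sum_empty]; positivity

/-- The new norm. -/
def renorm (xs : N → X →L[𝕜] 𝕜) (α η δ : ℝ) (f : X) : ℝ :=
  sSup {r : ℝ | ∃ (D E : Finset N) (h : N → ℝ), IsAdmissible xs α η δ D E h ∧
    r = mixedSum α D E h fun n => ‖xs n f‖}

lemma renorm_le (hδ : 0 ≤ δ) {f : X} {b : ℝ}
    (hb : ∀ D E h, IsAdmissible xs α η δ D E h → mixedSum α D E h (fun n => ‖xs n f‖) ≤ b) :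
    renorm xs α η δ f ≤ b := by
  refine csSup_le ⟨_, ∅, ∅, 0, isAdmissible_empty_right hδ ∅, rfl⟩ ?_
  rintro r ⟨D, E, h, hadm, rfl⟩
  exact hb D E h hadm

lemma renorm_nonneg (f : X) : 0 ≤ renorm xs α η δ f := by
  refine Real.sSup_nonneg ?_
  rintro r ⟨D, E, h, hadm, rfl⟩
  exact mixedSum_nonneg hadm.nonneg fun n => norm_nonneg _

section Bounded

variable {L : ℝ} (hα1 : α < 1) (hδ : 0 ≤ δ) (hL0 : 0 ≤ L)
  (hL : ∀ (D : Finset N) (f : X), ∑ n ∈ D, ‖xs n f‖ ≤ L * (D.card : ℝ) ^ (1 - α) * ‖f‖)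

include hα1 hL0 hL

lemma mixedSum_le_mul_norm {D E : Finset N} {h : N → ℝ} (hadm : IsAdmissible xs α η δ D E h)
    (f : X) : mixedSum α D E h (fun n => ‖xs n f‖) ≤ (L + δ) * ‖f‖ := by
  have hw := (powWeight_pos α D.card).le
  have h1 : powWeight α D.card * ∑ n ∈ D, ‖xs n f‖ ≤ L * ‖f‖ := by
    calc powWeight α D.card * ∑ n ∈ D, ‖xs n f‖
        ≤ powWeight α D.card * (L * (D.card : ℝ) ^ (1 - α) * ‖f‖) := by gcongr; exact hL D f
      _ = (powWeight α D.card * (D.card : ℝ) ^ (1 - α)) * (L * ‖f‖) := by ring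
      _ ≤ 1 * (L * ‖f‖) := by gcongr; exact powWeight_mul_rpow_le_one hα1 _
      _ = L * ‖f‖ := one_mul _
  rw [add_mul]
  exact add_le_add h1 (hadm.sum_le f)

lemma mixedSum_le_renorm {D E : Finset N} {h : N → ℝ} (hadm : IsAdmissible xs α η δ D E h)
    (f : X) : mixedSum α D E h (fun n => ‖xs n f‖) ≤ renorm xs α η δ f := by
  refine le_csSup ⟨(L + δ) * ‖f‖, ?_⟩ ⟨D, E, h, hadm, rfl⟩
  rintro r ⟨D, E, h, hadm, rfl⟩
  exact mixedSum_le_mul_norm hα1 hL0 hL hadm f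

include hδ

lemma renorm_le_mul_norm (f : X) : renorm xs α η δ f ≤ (L + δ) * ‖f‖ :=
  renorm_le hδ fun _ _ _ hadm => mixedSum_le_mul_norm hα1 hL0 hL hadm f

lemma renorm_add_le (f g : X) :
    renorm xs α η δ (f + g) ≤ renorm xs α η δ f + renorm xs α η δ g := by
  refine renorm_le hδ fun D E h hadm => ?_
  calc mixedSum α D E h (fun n => ‖xs n (f + g)‖)
      ≤ mixedSum α D E h (fun n => ‖xs n f‖ + ‖xs n g‖) :=
        mixedSum_mono hadm.nonneg fun n => by rw [map_add]; exact norm_add_le _ _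
    _ ≤ _ := by
        rw [mixedSum_add]
        exact add_le_add (mixedSum_le_renorm hα1 hL0 hL hadm f)
          (mixedSum_le_renorm hα1 hL0 hL hadm g)

lemma renorm_le_mul_renorm {f g : X} {M : ℝ} (hM : 0 ≤ M)
    (hfg : ∀ n, ‖xs n f‖ ≤ M * ‖xs n g‖) : renorm xs α η δ f ≤ M * renorm xs α η δ g := by
  refine renorm_le hδ fun D E h hadm => ?_
  refine (mixedSum_mono hadm.nonneg hfg).trans ?_
  rw [mixedSum_const_mul]
  exact mul_le_mul_of_nonneg_left (mixedSum_le_renorm hα1 hL0 hL hadm g) hM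

lemma renorm_smul (a : 𝕜) (f : X) : renorm xs α η δ (a • f) = ‖a‖ * renorm xs α η δ f := by
  refine le_antisymm (renorm_le_mul_renorm hα1 hδ hL0 hL (norm_nonneg a) fun n => ?_) ?_
  · rw [map_smul, norm_smul]
  rcases eq_or_ne a 0 with rfl | ha
  · rw [norm_zero, zero_mul]; exact renorm_nonneg _
  have ha' : 0 < ‖a‖ := norm_pos_iff.2 ha
  rw [← le_div_iff₀' ha', div_eq_inv_mul]
  refine renorm_le_mul_renorm hα1 hδ hL0 hL (by positivity) fun n => ?_
  rw [map_smul, norm_smul, inv_mul_cancel_left₀ ha'.ne']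

lemma latticeUnconditionalWith_renorm [Nonempty N] (hb : IsBasis x xs) :
    LatticeUnconditionalWith (renorm xs α η δ) x xs 1 := by
  intro f A lam M hM
  obtain ⟨n₀⟩ := ‹Nonempty N›
  have hM0 : 0 ≤ M := (norm_nonneg _).trans (hM n₀)
  rw [one_mul]
  refine renorm_le_mul_renorm hα1 hδ hL0 hL hM0 fun n => ?_
  simp only [smul_smul]
  rw [hb.coord_sum]
  split_ifs
  · rw [norm_mul]; gcongr; exact hM n
  · rw [norm_zero]; positivity

lemma sum_norm_coord_le_mul_renorm (B : Finset N) (f : X) :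
    ∑ n ∈ B, ‖xs n f‖ ≤ (B.card : ℝ) ^ (1 - α) * renorm xs α η δ f := by
  rcases B.eq_empty_or_nonempty with rfl | hB
  · rw [Finset.sum_empty]
    exact mul_nonneg (by positivity) (renorm_nonneg f)
  have h := mixedSum_le_renorm hα1 hL0 hL (isAdmissible_empty_right (η := η) hδ B) f
  rw [mixedSum, Finset.sum_empty, add_zero] at h
  have hB1 : 1 ≤ B.card := Finset.card_pos.2 hB
  have hB' : (0 : ℝ) < B.card := by exact_mod_cast hB1
  have h1 : (B.card : ℝ) ^ (1 - α) * powWeight α B.card = 1 := by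
    rw [powWeight_of_one_le α hB1, ← Real.rpow_add hB']; simp
  calc ∑ n ∈ B, ‖xs n f‖
      = (B.card : ℝ) ^ (1 - α) * (powWeight α B.card * ∑ n ∈ B, ‖xs n f‖) := by
        rw [← mul_assoc, h1, one_mul]
    _ ≤ _ := by gcongr

/-- The new norm dominates the original one. -/
lemma mul_norm_le_renorm {K : ℝ} (hK1 : 1 ≤ K) (hb : IsBasis x xs)
    (hK : ∀ (A : Finset N) (f : X), ‖greedyProj x xs A f‖ ≤ K * ‖f‖)
    (hx : ∀ n, δ * ‖x n‖ ≤ η) (f : X) : δ / (4 * K) * ‖f‖ ≤ renorm xs α η δ f := by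
  classical
  have hcont : Continuous (renorm xs α η δ) := by
    refine (LipschitzWith.of_le_add_mul (⟨L + δ, by positivity⟩ : ℝ≥0) fun f g => ?_).continuous
    have h1 := renorm_add_le (η := η) hα1 hδ hL0 hL g (f - g)
    have h2 := renorm_le_mul_norm (η := η) hα1 hδ hL0 hL (f - g)
    rw [add_sub_cancel] at h1
    rw [dist_eq_norm]
    exact h1.trans (add_le_add le_rfl h2)
  have hclosed : IsClosed {f : X | δ / (4 * K) * ‖f‖ ≤ renorm xs α η δ f} :=
    isClosed_le (by fun_prop) hcont
  have hf : f ∈ closure (Submodule.span 𝕜 (Set.range x) : Set X) := by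
    rw [← Submodule.topologicalClosure_coe, hb.dense_span]; trivial
  refine closure_minimal ?_ hclosed hf
  intro p hp
  obtain ⟨c, hc⟩ := Finsupp.mem_span_range_iff_exists_finsupp.1 hp
  have hp' : p = ∑ n ∈ c.support, xs n p • x n := by
    rw [← hc, Finsupp.sum]
    exact Finset.sum_congr rfl fun n hn => by rw [hb.coord_sum_of_mem _ hn]
  obtain ⟨g, hg1, hg⟩ := exists_dual_vector'' 𝕜 p
  have h0 : 0 ≤ δ / (4 * K) := by positivity
  have hadm : IsAdmissible xs α η δ ∅ c.support fun n => δ / (4 * K) * ‖g (x n)‖ := by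
    refine ⟨Finset.disjoint_empty_left _, fun n => by positivity, fun n _ => ?_, fun f => ?_⟩
    · have hg' : ‖g (x n)‖ ≤ ‖x n‖ := (g.le_of_opNorm_le hg1 _).trans_eq (one_mul _)
      have hw : powWeight α (∅ : Finset N).card = 1 := by simp [powWeight]
      rw [hw, mul_one]
      refine le_trans ?_ (hx n)
      gcongr
      exact div_le_self hδ (by linarith)
    · have h := sum_norm_coord_mul_norm_apply_le hK c.support f g hg1
      calc ∑ n ∈ c.support, δ / (4 * K) * ‖g (x n)‖ * ‖xs n f‖
          = δ / (4 * K) * ∑ n ∈ c.support, ‖xs n f‖ * ‖g (x n)‖ := by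
            rw [Finset.mul_sum]; exact Finset.sum_congr rfl fun n _ => by ring
        _ ≤ δ / (4 * K) * (4 * K * ‖f‖) := by gcongr
        _ = δ * ‖f‖ := by field_simp
  refine le_trans ?_ (mixedSum_le_renorm hα1 hL0 hL hadm p)
  have hnorm : ‖p‖ ≤ ∑ n ∈ c.support, ‖g (x n)‖ * ‖xs n p‖ := by
    have h := congrArg (fun z : 𝕜 => ‖z‖) hg
    simp only [RCLike.norm_ofReal, abs_norm] at h
    rw [← h]
    conv_lhs => rw [hp', map_sum]
    refine (norm_sum_le _ _).trans_eq (Finset.sum_congr rfl fun n _ => ?_)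
    rw [map_smul, norm_smul, mul_comm]
  rw [mixedSum, Finset.sum_empty, mul_zero, zero_add]
  simp only [mul_assoc]
  rw [← Finset.mul_sum]
  exact mul_le_mul_of_nonneg_left hnorm h0

end Bounded

lemma IsAdmissible.sum_weight_le {D₀ : ℝ} (hb : IsBasis x xs) (hδ : 0 ≤ δ) (hδη : δ * D₀ ≤ η)
    (hup : ∀ (A : Finset N) (ε : N → 𝕜), (∀ n, ‖ε n‖ = 1) →
      ‖∑ n ∈ A, ε n • x n‖ ≤ D₀ * (A.card : ℝ) ^ α)
    {D E : Finset N} {h : N → ℝ} (hadm : IsAdmissible xs α η δ D E h) :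
    ∀ F ⊆ E, ∑ n ∈ F, h n ≤ η * (F.card : ℝ) ^ α := by
  classical
  intro F hF
  have h1 := hadm.sum_le (∑ n ∈ F, (1 : 𝕜) • x n)
  have h2 : ∑ n ∈ F, h n ≤ ∑ n ∈ E, h n * ‖xs n (∑ n ∈ F, (1 : 𝕜) • x n)‖ := by
    rw [← Finset.sum_subset hF fun n _ hn => by
      rw [hb.coord_sum_of_notMem _ hn, norm_zero, mul_zero]]
    refine le_of_eq (Finset.sum_congr rfl fun n hn => ?_)
    rw [hb.coord_sum_of_mem _ hn, norm_one, mul_one]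
  calc ∑ n ∈ F, h n ≤ δ * ‖∑ n ∈ F, (1 : 𝕜) • x n‖ := h2.trans h1
    _ ≤ δ * (D₀ * (F.card : ℝ) ^ α) := by
        gcongr; exact hup F (fun _ => 1) fun _ => norm_one
    _ = δ * D₀ * (F.card : ℝ) ^ α := by ring
    _ ≤ _ := by gcongr

section Isometric

variable {L : ℝ} (hα0 : 0 < α) (hα1 : α < 1) (hη : 0 < η) (hηα : 6 * η ≤ α) (hδ : 0 ≤ δ)
  (hL0 : 0 ≤ L)
  (hL : ∀ (D : Finset N) (f : X), ∑ n ∈ D, ‖xs n f‖ ≤ L * (D.card : ℝ) ^ (1 - α) * ‖f‖)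
  (hsum : ∀ (D E : Finset N) (h : N → ℝ), IsAdmissible xs α η δ D E h →
    ∀ F ⊆ E, ∑ n ∈ F, h n ≤ η * (F.card : ℝ) ^ α)
  (hb : IsBasis x xs)

include hα0 hα1 hη hηα hδ hL0 hL hsum hb

lemma renorm_sum_smul (A : Finset N) {ε : N → 𝕜} (hε : ∀ n, ‖ε n‖ = 1) :
    renorm xs α η δ (∑ n ∈ A, ε n • x n) = (A.card : ℝ) ^ α := by
  classical
  refine le_antisymm (renorm_le hδ fun D E h hadm => ?_) ?_
  · refine mixedSum_indicator_le hα0 hα1 hη hηα hadm.disj hadm.nonneg hadm.le_weight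
      (hsum D E h hadm) A (fun n hn => ?_) fun n hn => ?_
    · rw [hb.coord_sum_of_mem _ hn, hε]
    · rw [hb.coord_sum_of_notMem _ hn, norm_zero]
  · refine le_trans (le_of_eq ?_) (mixedSum_le_renorm hα1 hL0 hL
      (isAdmissible_empty_right (η := η) hδ A) _)
    rw [mixedSum, Finset.sum_empty, add_zero, Finset.sum_congr rfl fun n hn => by
      rw [hb.coord_sum_of_mem ε hn, hε], Finset.sum_const, nsmul_eq_mul, mul_one, mul_comm,
      mul_powWeight hα0]

lemma bidemocraticWith_renorm : BidemocraticWith (renorm xs α η δ) x xs 1 := by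
  intro A B ε θ hε hθ
  rw [renorm_sum_smul hα0 hα1 hη hηα hδ hL0 hL hsum hb A hε, one_mul]
  have hdual : dualNormWith (renorm xs α η δ) (∑ n ∈ B, θ n • xs n) ≤ (B.card : ℝ) ^ (1 - α) := by
    refine Real.sSup_le ?_ (by positivity)
    rintro r ⟨f, hf, rfl⟩
    calc ‖(∑ n ∈ B, θ n • xs n) f‖ ≤ ∑ n ∈ B, ‖xs n f‖ := by
          rw [sum_apply]
          refine (norm_sum_le _ _).trans_eq (Finset.sum_congr rfl fun n _ => ?_)
          rw [smul_apply, norm_smul, hθ, one_mul]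
      _ ≤ (B.card : ℝ) ^ (1 - α) * renorm xs α η δ f :=
          sum_norm_coord_le_mul_renorm hα1 hδ hL0 hL B f
      _ ≤ _ := mul_le_of_le_one_right (by positivity) hf
  set m := max A.card B.card with hm
  have hA : (A.card : ℝ) ≤ (m : ℝ) := by exact_mod_cast le_max_left _ _
  have hB : (B.card : ℝ) ≤ (m : ℝ) := by exact_mod_cast le_max_right _ _
  have hα' : 0 < 1 - α := by linarith
  calc (A.card : ℝ) ^ α * dualNormWith (renorm xs α η δ) (∑ n ∈ B, θ n • xs n)
      ≤ (A.card : ℝ) ^ α * (B.card : ℝ) ^ (1 - α) := by gcongr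
    _ ≤ (m : ℝ) ^ α * (m : ℝ) ^ (1 - α) := by gcongr
    _ = m := by
        rw [← Real.rpow_add_of_nonneg (by positivity) hα0.le hα'.le]
        simp

lemma fundFunWith_renorm [Infinite N] (m : ℕ) :
    fundFunWith 𝕜 (renorm xs α η δ) x m = (m : ℝ) ^ α := by
  refine IsGreatest.csSup_eq ⟨?_, ?_⟩
  · obtain ⟨A, hA⟩ := Infinite.exists_subset_card_eq N m
    refine ⟨A, fun _ => 1, hA.le, fun _ => norm_one, ?_⟩
    rw [renorm_sum_smul hα0 hα1 hη hηα hδ hL0 hL hsum hb A fun _ => norm_one, hA]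
  · rintro r ⟨A, ε, hA, hε, rfl⟩
    rw [renorm_sum_smul hα0 hα1 hη hηα hδ hL0 hL hsum hb A hε]
    gcongr

lemma greedyWith_renorm : GreedyWith (renorm xs α η δ) x xs 1 := by
  classical
  intro f A B a hgr hBA
  rw [one_mul]
  rcases A.eq_empty_or_nonempty with rfl | hA
  · have hB : B = ∅ := Finset.card_eq_zero.1 (by simpa using hBA)
    simp [hB, greedyProj]
  obtain ⟨k, hk, hmin⟩ := A.exists_min_image (fun n => ‖xs n f‖) hA
  obtain ⟨G, hGs, hG⟩ := Finset.exists_subset_card_eq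
    (Finset.card_sdiff_le_card_sdiff_iff.2 hBA)
  have hGA : ∀ n ∈ G, n ∈ A ∧ n ∉ B := fun n hn => Finset.mem_sdiff.1 (hGs hn)
  have huA : ∀ n ∈ A, xs n (f - greedyProj x xs A f) = 0 := fun n hn => by
    rw [map_sub, greedyProj, hb.coord_sum_of_mem _ hn, sub_self]
  have huA' : ∀ n ∉ A, xs n (f - greedyProj x xs A f) = xs n f := fun n hn => by
    rw [map_sub, greedyProj, hb.coord_sum_of_notMem _ hn, sub_zero]
  have hyB : ∀ n ∉ B, xs n (f - ∑ n ∈ B, a n • x n) = xs n f := fun n hn => by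
    rw [map_sub, hb.coord_sum_of_notMem _ hn, sub_zero]
  refine renorm_le hδ fun D E h hadm => ?_
  obtain ⟨D', E', h', hdisj, hE'E, hpos', hle', hwt', hval⟩ := exists_mixedSum_le hα0 hα1 hη hηα
    hadm.disj hadm.nonneg hadm.le_weight (hsum D E h hadm) (A := B \ A) (B := G)
    (u := fun n => ‖xs n (f - greedyProj x xs A f)‖)
    (y := fun n => ‖xs n (f - ∑ n ∈ B, a n • x n)‖) (t := ‖xs k f‖)
    (Finset.disjoint_left.2 fun n hn hn' => (Finset.mem_sdiff.1 hn).2 (hGA n hn').1)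
    hG.symm (fun n => norm_nonneg _)
    (fun n => by
      by_cases hn : n ∈ A
      · simp [huA n hn]
      · simpa only [huA' n hn] using hgr k hk n hn)
    (fun n hn => by simp [huA n (hGA n hn).1])
    (fun n hn => by simpa only [hyB n (hGA n hn).2] using hmin n (hGA n hn).1)
    (fun n hn => by
      by_cases hnA : n ∈ A
      · simp [huA n hnA]
      · have hnB : n ∉ B := fun hnB => hn (Finset.mem_sdiff.2 ⟨hnB, hnA⟩)
        simp only [huA' n hnA, hyB n hnB, le_refl])
  refine hval.trans (mixedSum_le_renorm hα1 hL0 hL ⟨hdisj, hpos', hwt', fun g => ?_⟩ _)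
  refine le_trans ?_ (hadm.sum_le g)
  calc ∑ n ∈ E', h' n * ‖xs n g‖ ≤ ∑ n ∈ E', h n * ‖xs n g‖ := by
        gcongr with n _; exact hle' n
    _ ≤ _ := Finset.sum_le_sum_of_subset_of_nonneg hE'E fun n _ _ =>
        mul_nonneg (hadm.nonneg n) (norm_nonneg _)

end Isometric

end Renorming

/-- Theorem 4.6: a greedy basis whose fundamental function is
equivalent to `m ↦ m^α` for some `0 < α < 1` admits a renorming which is isometrically
greedy, isometrically bidemocratic, lattice `1`-unconditional, and whose fundamental
function is exactly `m ↦ m^α`. -/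
theorem greedy_power_fundFun_renorming {𝕜 : Type*} [RCLike 𝕜] {N : Type*} [Countable N]
    {X : Type*} [NormedAddCommGroup X] [NormedSpace 𝕜 X] [CompleteSpace X]
    (x : N → X) (xs : N → X →L[𝕜] 𝕜) (hb : IsBasis x xs)
    (hg : ∃ C : ℝ, 1 ≤ C ∧ GreedyWith (fun f : X => ‖f‖) x xs C)
    (α : ℝ) (hα0 : 0 < α) (hα1 : α < 1)
    (hequiv : EquivSeq (fundFun 𝕜 x) (fun m : ℕ => (m : ℝ) ^ α)) :
    ∃ ν : X → ℝ, IsEquivNorm 𝕜 ν ∧ GreedyWith ν x xs 1 ∧ BidemocraticWith ν x xs 1 ∧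
      LatticeUnconditionalWith ν x xs 1 ∧
      ∀ m : ℕ, 1 ≤ m → fundFunWith 𝕜 ν x m = (m : ℝ) ^ α := by
  obtain ⟨C, hC1, hC⟩ := hg
  obtain ⟨D₀, hD₀, hD⟩ := hequiv
  have hinf : Infinite N := by
    by_contra hfin
    rw [not_infinite_iff_finite] at hfin
    have := Fintype.ofFinite N
    set d := Fintype.card N with hd
    have hup : ∀ m : ℕ, fundFun 𝕜 x m ≤ D₀ * (d : ℝ) ^ α := by
      intro m
      refine csSup_le ⟨_, ∅, fun _ => 1, by simp, by simp, rfl⟩ ?_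
      rintro r ⟨A, ε, -, hε, rfl⟩
      refine (EquivSeq.norm_sum_smul_le hD₀ hD A hε).trans ?_
      gcongr
      exact Finset.card_le_univ A
    obtain ⟨m, hm1, hm⟩ := (((tendsto_rpow_atTop hα0).comp tendsto_natCast_atTop_atTop).eventually
      (Filter.eventually_gt_atTop (D₀ * (D₀ * (d : ℝ) ^ α)))).and
        (Filter.eventually_ge_atTop 1) |>.exists
    have h := (hD m hm).1.trans (hup m)
    rw [one_div, inv_mul_le_iff₀ (by linarith)] at h
    exact absurd hm1 (not_lt.2 h)
  have hproj := hC.norm_greedyProj_le hb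
  have hlat := latticeUnconditionalWith_norm hproj
  have hup : ∀ (A : Finset N) (ε : N → 𝕜), (∀ n, ‖ε n‖ = 1) →
      ‖∑ n ∈ A, ε n • x n‖ ≤ D₀ * (A.card : ℝ) ^ α :=
    fun A ε hε => EquivSeq.norm_sum_smul_le hD₀ hD A hε
  obtain ⟨c, hc, hlow⟩ := exists_le_norm_sum (C := 4 * (C + 1) + C) hα0 hD₀ (by linarith)
    (fun m hm => (hD m hm).1) fun A D ε hAD hε => hC.norm_sum_smul_le hb hlat hAD hε
  obtain ⟨L, hL0, hL⟩ := exists_sum_norm_coord_le hα0 hα1 hc (by linarith) hlat hlow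
  set η := α / 6 with hηdef
  have hη : 0 < η := by positivity
  set δ := η / D₀ with hδdef
  have hδ : 0 < δ := by positivity
  have hδη : δ * D₀ = η := div_mul_cancel₀ _ (by linarith)
  have hηα : 6 * η ≤ α := by linarith
  have hsum : ∀ (D E : Finset N) (h : N → ℝ), IsAdmissible xs α η δ D E h →
      ∀ F ⊆ E, ∑ n ∈ F, h n ≤ η * (F.card : ℝ) ^ α :=
    fun D E h hadm => hadm.sum_weight_le hb hδ.le hδη.le hup
  have hx : ∀ n, δ * ‖x n‖ ≤ η := fun n => by
    have := hup {n} (fun _ => 1) fun _ => norm_one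
    simp only [Finset.sum_singleton, one_smul, Finset.card_singleton, Nat.cast_one,
      Real.one_rpow, mul_one] at this
    rw [← hδη]
    gcongr
  refine ⟨renorm xs α η δ, ⟨renorm_add_le hα1 hδ.le hL0 hL, renorm_smul hα1 hδ.le hL0 hL,
    ⟨δ / (4 * (C + 1)), by positivity,
      mul_norm_le_renorm hα1 hδ.le hL0 hL (by linarith) hb hproj hx⟩,
    ⟨L + δ, by positivity, renorm_le_mul_norm hα1 hδ.le hL0 hL⟩⟩,
    greedyWith_renorm hα0 hα1 hη hηα hδ.le hL0 hL hsum hb,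
    bidemocraticWith_renorm hα0 hα1 hη hηα hδ.le hL0 hL hsum hb,
    latticeUnconditionalWith_renorm hα1 hδ.le hL0 hL hb,
    fun m _ => fundFunWith_renorm hα0 hα1 hη hηα hδ.le hL0 hL hsum hb m⟩

end GreedyRenorm
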